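/- arXiv:2108.01478 — 5 statements merged into one kernel-verified Lean document; each statement's English description precedes it below -/
import Mathlib

section
/- Let F, Ω ∈ ℝ, let H₀ : ℝ → ℝ be differentiable, and let Q : ℝ → ℂ be differentiable. Suppose J, ϑ : ℝ → ℝ are differentiable functions satisfying, for all t ∈ ℝ, (J'(t) : ℂ) = −(F/2)·(Q(J(t))·exp(i·ϑ(t)) + conj(Q(J(t)))·exp(−i·ϑ(t))) and (ϑ'(t) : ℂ) = H₀'(J(t)) − (i·F/2)·(Q'(J(t))·exp(i·ϑ(t)) − conj(Q'(J(t)))·exp(−i·ϑ(t))) − Ω. Then the function t ↦ H₀(J(t)) − (i·F/2)·(Q(J(t))·exp(i·ϑ(t)) − conj(Q(J(t)))·exp(−i·ϑ(t))) − Ω·J(t) is constant on ℝ. -/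
/-- Conservation law (first integral) of the complex slow-flow equations near the
1:1 resonance. -/
theorem slow_flow_conservation_complex (F Ω : ℝ) (H₀ : ℝ → ℝ) (Q : ℝ → ℂ)
    (J ϑ : ℝ → ℝ)
    (hH₀ : Differentiable ℝ H₀) (hQ : Differentiable ℝ Q)
    (hJ : Differentiable ℝ J) (hϑ : Differentiable ℝ ϑ)
    (hJ' : ∀ t : ℝ, (Complex.ofReal (deriv J t)) =
      -(F / 2) * (Q (J t) * Complex.exp (Complex.I * ϑ t) +
        (starRingEnd ℂ) (Q (J t)) * Complex.exp (-(Complex.I * ϑ t))))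
    (hϑ' : ∀ t : ℝ, (Complex.ofReal (deriv ϑ t)) =
      (Complex.ofReal (deriv H₀ (J t))) - Complex.I * F / 2 *
        (deriv Q (J t) * Complex.exp (Complex.I * ϑ t) -
          (starRingEnd ℂ) (deriv Q (J t)) * Complex.exp (-(Complex.I * ϑ t))) - Ω) :
    ∀ s t : ℝ,
      (Complex.ofReal (H₀ (J s))) - Complex.I * F / 2 *
          (Q (J s) * Complex.exp (Complex.I * ϑ s) -
            (starRingEnd ℂ) (Q (J s)) * Complex.exp (-(Complex.I * ϑ s))) - Ω * J s
        =
      (Complex.ofReal (H₀ (J t))) - Complex.I * F / 2 *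
          (Q (J t) * Complex.exp (Complex.I * ϑ t) -
            (starRingEnd ℂ) (Q (J t)) * Complex.exp (-(Complex.I * ϑ t))) - Ω * J t := by
  have key : ∀ t : ℝ, HasDerivAt (fun s : ℝ => (Complex.ofReal (H₀ (J s))) - Complex.I * F / 2 *
          (Q (J s) * Complex.exp (Complex.I * ϑ s) -
            (starRingEnd ℂ) (Q (J s)) * Complex.exp (-(Complex.I * ϑ s))) - Ω * J s) 0 t := by
    intro t
    have dJ := (hJ t).hasDerivAt
    have dJc : HasDerivAt (fun s : ℝ => (J s : ℂ)) (Complex.ofReal (deriv J t)) t := dJ.ofReal_comp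
    have dϑc : HasDerivAt (fun s : ℝ => (ϑ s : ℂ)) (Complex.ofReal (deriv ϑ t)) t :=
      (hϑ t).hasDerivAt.ofReal_comp
    have dH : HasDerivAt (fun s : ℝ => (H₀ (J s) : ℂ)) ((deriv H₀ (J t) * deriv J t : ℝ) : ℂ) t :=
      ((hH₀ (J t)).hasDerivAt.comp t dJ).ofReal_comp
    have dQ : HasDerivAt (fun s : ℝ => Q (J s)) ((Complex.ofReal (deriv J t)) * deriv Q (J t)) t := by
      have h := (hQ (J t)).hasDerivAt.scomp t dJ
      rw [Complex.real_smul] at h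
      exact h
    have dQc : HasDerivAt (fun s : ℝ => (starRingEnd ℂ) (Q (J s)))
        ((Complex.ofReal (deriv J t)) * (starRingEnd ℂ) (deriv Q (J t))) t := by
      have h := dQ.star
      simpa [mul_comm] using h
    have dE := (dϑc.const_mul Complex.I).cexp
    have dE' := (dϑc.const_mul Complex.I).neg.cexp
    have h := (dH.sub (((dQ.mul dE).sub (dQc.mul dE')).const_mul (Complex.I * F / 2))).sub
      (dJc.const_mul (Ω : ℂ))
    refine h.congr_deriv ?_
    have h1 := hJ' t
    have h2 := hϑ' t
    have hI := Complex.I_mul_I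
    simp only [Pi.neg_apply]
    push_cast
    generalize Complex.exp (Complex.I * ϑ t) = e at *
    generalize Complex.exp (-(Complex.I * ϑ t)) = e' at *
    linear_combination (-(Complex.ofReal (deriv J t))) * h2 + (Complex.ofReal (deriv ϑ t)) * h1 -
      (F / 2 * (Complex.ofReal (deriv ϑ t)) * (Q (J t) * e + (starRingEnd ℂ) (Q (J t)) * e')) * hI
  intro s t
  exact is_const_of_deriv_eq_zero (fun t => (key t).differentiableAt) (fun t => (key t).deriv) s t
end

section
/- Let α < 0 and 0 < β < 2α²/9, and let V : ℝ → ℝ be the quartic potential V(q) = q²/2 + (α/3)q³ + (β/4)q⁴. With q_thres = (−α − √(α²−4β))/(2β) and q₊ = (−α + √(α²−4β))/(2β), one has V(q₊) < 0 = V(0) < V(q_thres); that is, the second well is strictly deeper than the well at the origin and the barrier height is strictly positive. -/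
/-- Case I (double-well quartic potential): the second well is strictly deeper
than the well at the origin and the barrier height is strictly positive:
`V(q₊) < 0 = V(0) < V(q_thres)`. -/
theorem doubleWell_depths (α β : ℝ) (hα : α < 0) (hβ : 0 < β)
    (hβ' : β < 2 * α ^ 2 / 9)
    (V : ℝ → ℝ) (hV : ∀ q : ℝ, V q = q ^ 2 / 2 + α / 3 * q ^ 3 + β / 4 * q ^ 4)
    (qthres qplus : ℝ)
    (hqt : qthres = (-α - Real.sqrt (α ^ 2 - 4 * β)) / (2 * β))
    (hqp : qplus = (-α + Real.sqrt (α ^ 2 - 4 * β)) / (2 * β)) :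
    V qplus < 0 ∧ V 0 = 0 ∧ V 0 < V qthres := by
  have hd : 0 < α ^ 2 - 4 * β := by nlinarith
  have hs2 : Real.sqrt (α ^ 2 - 4 * β) ^ 2 = α ^ 2 - 4 * β := Real.sq_sqrt hd.le
  have hs0 : 0 < Real.sqrt (α ^ 2 - 4 * β) := Real.sqrt_pos.mpr hd
  set s := Real.sqrt (α ^ 2 - 4 * β) with hs
  have hs3 : -α / 3 < s := by
    apply lt_of_pow_lt_pow_left₀ 2 hs0.le
    nlinarith
  have hsa : s < -α := by
    apply lt_of_pow_lt_pow_left₀ 2 (by linarith)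
    nlinarith
  have hp1 : 2 * β * qplus = -α + s := by rw [hqp]; field_simp
  have ht1 : 2 * β * qthres = -α - s := by rw [hqt]; field_simp
  have key : ∀ q t : ℝ, 2 * β * q = -α + t → t ^ 2 = α ^ 2 - 4 * β →
      V q = q ^ 2 * ((3 + α * q) / 12) := by
    intro q t h1 h2
    have h3 : 1 + α * q + β * q ^ 2 = 0 := by
      have : 4 * β * (1 + α * q + β * q ^ 2) = 0 := by
        have : t = 2 * β * q + α := by linarith
        rw [this] at h2
        linarith
      rcases mul_eq_zero.mp this with h | h
      · linarith
      · exact h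
    rw [hV]
    linear_combination q ^ 2 / 4 * h3
  have hV0 : V 0 = 0 := by rw [hV]; norm_num
  have hpp : 0 < qplus := by
    rw [hqp]; apply div_pos <;> linarith
  have htp : 0 < qthres := by
    rw [hqt]; apply div_pos <;> linarith
  refine ⟨?_, hV0, ?_⟩
  · rw [key qplus s hp1 hs2]
    have : 3 + α * qplus < 0 := by
      by_contra! h
      have h5 : 0 ≤ 2 * β * (3 + α * qplus) := by positivity
      have h6 : 2 * β * (3 + α * qplus) = 6 * β + α * (-α + s) := by
        rw [← hp1]; ring
      nlinarith
    exact mul_neg_of_pos_of_neg (by positivity) (by linarith)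
  · rw [hV0, key qthres (-s) (by linarith) (by linarith [neg_sq s])]
    have : 0 < 3 + α * qthres := by
      by_contra! h
      have h5 : 2 * β * (3 + α * qthres) ≤ 0 :=
        mul_nonpos_of_nonneg_of_nonpos (by linarith) h
      have h6 : 2 * β * (3 + α * qthres) = 6 * β + α * (-α - s) := by
        rw [← ht1]; ring
      have h7 : 0 < (-α - s) * (-α + 3 * s) := mul_pos (by linarith) (by linarith)
      nlinarith
    positivity
end

section
/- Let α < 0 and 0 < β < 2α²/9, let V : ℝ → ℝ be the quartic potential V(q) = q²/2 + (α/3)q³ + (β/4)q⁴, set q_thres = (−α − √(α²−4β))/(2β), q₊ = (−α + √(α²−4β))/(2β) and E_max = V(q_thres). Then for every E with 0 < E < E_max there exist real numbers a > b > c > d such that E − V(q) = −(β/4)·(q − a)·(q − b)·(q − c)·(q − d) for all q ∈ ℝ, and moreover d < 0 < c < q_thres < b < q₊ < a. -/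
theorem cubic_zero_aux (e0 e1 e2 e3 a b c d : ℝ) (hab : b < a) (hbc : c < b) (hcd : d < c)
    (ha : e0 + e1 * a + e2 * a ^ 2 + e3 * a ^ 3 = 0)
    (hb : e0 + e1 * b + e2 * b ^ 2 + e3 * b ^ 3 = 0)
    (hc : e0 + e1 * c + e2 * c ^ 2 + e3 * c ^ 3 = 0)
    (hd : e0 + e1 * d + e2 * d ^ 2 + e3 * d ^ 3 = 0) (q : ℝ) :
    e0 + e1 * q + e2 * q ^ 2 + e3 * q ^ 3 = 0 := by
  have h1 : e1 + e2 * (a + b) + e3 * (a ^ 2 + a * b + b ^ 2) = 0 := by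
    apply mul_left_cancel₀ (sub_ne_zero.2 hab.ne'); linear_combination ha - hb
  have h2 : e1 + e2 * (a + c) + e3 * (a ^ 2 + a * c + c ^ 2) = 0 := by
    apply mul_left_cancel₀ (sub_ne_zero.2 (hbc.trans hab).ne'); linear_combination ha - hc
  have h3 : e1 + e2 * (a + d) + e3 * (a ^ 2 + a * d + d ^ 2) = 0 := by
    apply mul_left_cancel₀ (sub_ne_zero.2 (hcd.trans (hbc.trans hab)).ne')
    linear_combination ha - hd
  have h4 : e2 + e3 * (a + b + c) = 0 := by
    apply mul_left_cancel₀ (sub_ne_zero.2 hbc.ne'); linear_combination h1 - h2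
  have h5 : e2 + e3 * (a + c + d) = 0 := by
    apply mul_left_cancel₀ (sub_ne_zero.2 hcd.ne'); linear_combination h2 - h3
  have h6 : e3 = 0 := by
    apply mul_left_cancel₀ (sub_ne_zero.2 (hcd.trans hbc).ne'); linear_combination h4 - h5
  subst h6
  have h7 : e2 = 0 := by linarith
  subst h7
  have h8 : e1 = 0 := by linarith
  subst h8
  linarith


/-- Case I (double-well quartic potential): for every energy `0 < E < E_max`,
the quartic `E − V(q)` has four real roots `a > b > c > d` interlacing with
the critical points as `d < 0 < c < q_thres < b < q₊ < a`. -/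
theorem doubleWell_four_real_roots (α β : ℝ) (hα : α < 0) (hβ : 0 < β)
    (hβ' : β < 2 * α ^ 2 / 9)
    (V : ℝ → ℝ) (hV : ∀ q : ℝ, V q = q ^ 2 / 2 + α / 3 * q ^ 3 + β / 4 * q ^ 4)
    (qthres qplus Emax : ℝ)
    (hqt : qthres = (-α - Real.sqrt (α ^ 2 - 4 * β)) / (2 * β))
    (hqp : qplus = (-α + Real.sqrt (α ^ 2 - 4 * β)) / (2 * β))
    (hEmax : Emax = V qthres) :
    ∀ E : ℝ, 0 < E → E < Emax →
      ∃ a b c d : ℝ, b < a ∧ c < b ∧ d < c ∧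
        (∀ q : ℝ, E - V q = -(β / 4) * (q - a) * (q - b) * (q - c) * (q - d)) ∧
        d < 0 ∧ 0 < c ∧ c < qthres ∧ qthres < b ∧ b < qplus ∧ qplus < a := by
  intro E hE0 hE
  obtain ⟨s, hs⟩ : ∃ s, s = Real.sqrt (α ^ 2 - 4 * β) := ⟨_, rfl⟩
  rw [← hs] at hqt hqp
  have hs0 : 0 ≤ s := hs ▸ Real.sqrt_nonneg _
  have hs2 : s ^ 2 = α ^ 2 - 4 * β := by
    rw [hs]; apply Real.sq_sqrt; nlinarith
  have hs1 : s < -α := by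
    apply lt_of_pow_lt_pow_left₀ 2 (by linarith); nlinarith
  have hs3 : -α / 3 < s := by
    apply lt_of_pow_lt_pow_left₀ 2 hs0; nlinarith
  have hqt0 : 0 < qthres := by rw [hqt]; apply div_pos <;> linarith
  have hlt : qthres < qplus := by
    rw [hqt, hqp]; apply div_lt_div_of_pos_right <;> linarith
  have hqpu : qplus < -α / β := by
    rw [hqp, div_lt_div_iff₀ (by linarith) hβ]; nlinarith
  have hcrit : 1 + α * qplus + β * qplus ^ 2 = 0 := by
    rw [hqp]; field_simp; linear_combination hs2
  have haq : 3 + α * qplus < 0 := by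
    have : 2 * β * qplus = -α + s := by rw [hqp]; field_simp
    have h : 2 * β * (3 + α * qplus) < 0 := by
      have : 2 * β * (3 + α * qplus) = 6 * β + α * (-α + s) := by rw [← this]; ring
      rw [this]; nlinarith
    by_contra hc
    push Not at hc
    have := mul_nonneg (by linarith : (0:ℝ) ≤ 2 * β) hc
    linarith
  have hVp : V qplus < E := by
    have : V qplus = qplus ^ 2 * (3 + α * qplus) / 12 := by
      rw [hV]; linear_combination qplus ^ 2 / 4 * hcrit
    have := mul_nonneg (sq_nonneg qplus) (by linarith : 0 ≤ -(3 + α * qplus))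
    linarith
  have hV0 : V 0 < E := by rw [hV]; linarith
  rw [hEmax] at hE
  have hVc : Continuous V := by
    rw [funext hV]; fun_prop
  have hneg : E < V (-(1 + 2 * E)) := by
    rw [hV]
    have h1 : 0 ≤ -α * (1 + 2 * E) ^ 3 := mul_nonneg (by linarith) (by positivity)
    have h2 : 0 ≤ β * (1 + 2 * E) ^ 4 := by positivity
    nlinarith
  obtain ⟨t, ht⟩ : ∃ t, t = 4 / 3 * (-α / β) + (1 + 2 * E) := ⟨_, rfl⟩
  have hab0 : 0 < -α / β := div_pos (by linarith) hβ
  have htp : qplus < t := by linarith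
  have hpos : E < V t := by
    rw [hV]
    have h0 : 1 + 2 * E ≤ t := by linarith
    have h1 : β * t = 4 / 3 * (-α) + β * (1 + 2 * E) := by rw [ht]; field_simp
    have h2 : 0 ≤ t ^ 3 * (α / 3 + β / 4 * t) := by
      apply mul_nonneg (pow_nonneg (by linarith) 3)
      have : 0 ≤ β * (1 + 2 * E) := by positivity
      linarith
    nlinarith
  obtain ⟨d, ⟨hd1, hd2⟩, hd⟩ := intermediate_value_Ioo' (by linarith : -(1 + 2 * E) ≤ 0)
    hVc.continuousOn ⟨hV0, hneg⟩
  obtain ⟨c, ⟨hc1, hc2⟩, hc⟩ := intermediate_value_Ioo hqt0.le hVc.continuousOn ⟨hV0, hE⟩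
  obtain ⟨b, ⟨hb1, hb2⟩, hb⟩ := intermediate_value_Ioo' hlt.le hVc.continuousOn ⟨hVp, hE⟩
  obtain ⟨a, ⟨ha1, ha2⟩, ha⟩ := intermediate_value_Ioo htp.le hVc.continuousOn ⟨hVp, hpos⟩
  refine ⟨a, b, c, d, by linarith, by linarith, by linarith, ?_, hd2, hc1, hc2, hb1, hb2, ha1⟩
  intro q
  rw [hV] at ha hb hc hd ⊢
  have key := cubic_zero_aux (E + β / 4 * (a * b * c * d))
    (-(β / 4) * (a * b * c + a * b * d + a * c * d + b * c * d))
    (-1 / 2 + β / 4 * (a * b + a * c + a * d + b * c + b * d + c * d))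
    (-α / 3 - β / 4 * (a + b + c + d)) a b c d (by linarith) (by linarith) (by linarith)
    (by linear_combination -ha) (by linear_combination -hb)
    (by linear_combination -hc) (by linear_combination -hd) q
  linear_combination key
end

section
/- Let V : ℝ → ℝ be twice continuously differentiable, let E* ∈ ℝ and δ > 0, and let c, d : (E*−δ, E*+δ) → ℝ be differentiable functions such that for every E in this interval: d(E) < c(E), V(d(E)) = V(c(E)) = E, V(q) < E for all q ∈ (d(E), c(E)), and V'(d(E)) < 0 < V'(c(E)). Define I(E) = (√2/π) · ∫_{d(E)}^{c(E)} √(E − V(q)) dq. Then I is differentiable at E* and I'(E*) = (√2/(2π)) · ∫_{d(E*)}^{c(E*)} 1/√(E* − V(q)) dq. -/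
open Set intervalIntegral

open MeasureTheory Filter Topology in
lemma aux_int (V : ℝ → ℝ) (p : ℝ) (v : ℝ) (hv : v ≠ 0)
    (hp : HasDerivAt V v p) :
    ∃ η > 0, ∀ q, |q - p| < η → |v| / 2 * |q - p| ≤ |V p - V q| := by
  have h := (hasDerivAt_iff_tendsto_slope.1 hp).abs
  have h2 : ∀ᶠ q in 𝓝[≠] p, |v| / 2 < |slope V p q| :=
    h.eventually_const_lt (by have := abs_pos.2 hv; linarith)
  rw [eventually_nhdsWithin_iff, Metric.eventually_nhds_iff] at h2
  obtain ⟨η, hη, H⟩ := h2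
  refine ⟨η, hη, fun q hq => ?_⟩
  by_cases hqp : q = p
  · simp [hqp]
  have h3 := H (y := q) (by simpa [Real.dist_eq] using hq) hqp
  rw [slope_def_field, abs_div, lt_div_iff₀ (abs_pos.2 (sub_ne_zero.2 hqp))] at h3
  rw [abs_sub_comm (V p)]
  exact h3.le

open MeasureTheory Filter Topology in
lemma aux_int2 (V : ℝ → ℝ) (hVc : Continuous V) (p m a b : ℝ) (hm : 0 < m)
    (h : ∀ q ∈ uIoc a b, m * |q - p| ≤ |V p - V q|) :
    IntervalIntegrable (fun q => 1 / Real.sqrt |V p - V q|) volume a b := by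
  have h1 : IntervalIntegrable (fun q : ℝ => (q - p) ^ (-(1/2) : ℝ)) volume a b := by
    have := (intervalIntegrable_rpow' (r := -(1/2)) (a := a - p) (b := b - p)
      (by norm_num)).comp_sub_right p
    simpa using this
  have h2 : IntervalIntegrable (fun q : ℝ => (p - q) ^ (-(1/2) : ℝ)) volume a b := by
    have := (intervalIntegrable_rpow' (r := -(1/2)) (a := p - a) (b := p - b)
      (by norm_num)).comp_sub_left p
    simpa using this
  refine ((h1.norm.add h2.norm).const_mul (1 / Real.sqrt m)).mono_fun' ?_ ?_
  · exact Measurable.aestronglyMeasurable (by fun_prop)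
  · refine (ae_restrict_iff' measurableSet_uIoc).2 ?_
    have hne : ∀ᵐ q : ℝ, q ≠ p := by simp [ae_iff]
    filter_upwards [hne] with q hq hqI
    have hpos : 0 < |q - p| := abs_pos.2 (sub_ne_zero.2 hq)
    have e1 : ‖(1 / Real.sqrt |V p - V q| : ℝ)‖ = 1 / Real.sqrt |V p - V q| :=
      Real.norm_of_nonneg (by positivity)
    have e2 : 1 / Real.sqrt |V p - V q| ≤ 1 / Real.sqrt (m * |q - p|) :=
      one_div_le_one_div_of_le (by positivity) (Real.sqrt_le_sqrt (h q hqI))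
    have e3 : 1 / Real.sqrt (m * |q - p|) = 1 / Real.sqrt m * |q - p| ^ (-(1/2) : ℝ) := by
      rw [Real.sqrt_mul hm.le, Real.rpow_neg hpos.le, ← Real.sqrt_eq_rpow]
      field_simp
    have e4 : |q - p| ^ (-(1/2) : ℝ) ≤ ‖(q - p) ^ (-(1/2) : ℝ)‖ + ‖(p - q) ^ (-(1/2) : ℝ)‖ := by
      rcases le_total 0 (q - p) with h0 | h0
      · rw [abs_of_nonneg h0]
        have := le_abs_self ((q - p) ^ (-(1/2) : ℝ))
        have := norm_nonneg ((p - q) ^ (-(1/2) : ℝ))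
        simp only [Real.norm_eq_abs] at *
        linarith
      · rw [abs_of_nonpos h0, neg_sub]
        have := le_abs_self ((p - q) ^ (-(1/2) : ℝ))
        have := norm_nonneg ((q - p) ^ (-(1/2) : ℝ))
        simp only [Real.norm_eq_abs] at *
        linarith
    rw [e1]
    refine e2.trans (e3.le.trans ?_)
    exact mul_le_mul_of_nonneg_left e4 (by positivity)

lemma aux_sqrt (a b : ℝ) (hb : b ≠ 0) :
    |Real.sqrt a - Real.sqrt b| ≤ 1 / Real.sqrt |b| * |a - b| := by
  have hs : 0 < Real.sqrt |b| := Real.sqrt_pos.2 (abs_pos.2 hb)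
  rw [one_div, inv_mul_eq_div, le_div_iff₀ hs]
  rcases lt_or_gt_of_ne hb with h | h
  · rw [Real.sqrt_eq_zero_of_nonpos h.le, sub_zero, abs_of_nonneg (Real.sqrt_nonneg _),
      abs_of_neg h]
    rw [abs_of_neg h] at hs
    rcases le_total a 0 with ha | ha
    · rw [Real.sqrt_eq_zero_of_nonpos ha]; simp
    · have h1 := Real.sq_sqrt ha
      have h2 := Real.sq_sqrt (neg_pos.2 h).le
      rw [abs_of_nonneg (by linarith)]
      nlinarith [sq_nonneg (Real.sqrt a - Real.sqrt (-b)), Real.sqrt_nonneg a]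
  · rw [abs_of_pos h] at *
    have h2 := Real.sq_sqrt h.le
    rcases le_total a 0 with ha | ha
    · rw [Real.sqrt_eq_zero_of_nonpos ha, zero_sub, abs_neg, abs_of_nonneg hs.le,
        abs_of_nonpos (by linarith)]
      nlinarith
    · have h1 := Real.sq_sqrt ha
      have : a - b = (Real.sqrt a - Real.sqrt b) * (Real.sqrt a + Real.sqrt b) := by
        linear_combination h2 - h1
      rw [this, abs_mul, abs_of_nonneg (a := Real.sqrt a + Real.sqrt b) (by positivity)]
      exact mul_le_mul_of_nonneg_left (by linarith [Real.sqrt_nonneg a]) (abs_nonneg _)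


/-- Differentiability of the action variable `I(E)` with respect to the
energy, and the formula `I'(E*) = (√2/(2π)) ∫ dq/√(E* − V(q))`. -/
theorem action_hasDerivAt (V : ℝ → ℝ) (hV : ContDiff ℝ 2 V)
    (Estar δ : ℝ) (hδ : 0 < δ)
    (c d : ℝ → ℝ)
    (hc : DifferentiableOn ℝ c (Set.Ioo (Estar - δ) (Estar + δ)))
    (hd : DifferentiableOn ℝ d (Set.Ioo (Estar - δ) (Estar + δ)))
    (hord : ∀ E ∈ Set.Ioo (Estar - δ) (Estar + δ), d E < c E)
    (hVd : ∀ E ∈ Set.Ioo (Estar - δ) (Estar + δ), V (d E) = E)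
    (hVc : ∀ E ∈ Set.Ioo (Estar - δ) (Estar + δ), V (c E) = E)
    (hlt : ∀ E ∈ Set.Ioo (Estar - δ) (Estar + δ),
      ∀ q ∈ Set.Ioo (d E) (c E), V q < E)
    (hd' : ∀ E ∈ Set.Ioo (Estar - δ) (Estar + δ), deriv V (d E) < 0)
    (hc' : ∀ E ∈ Set.Ioo (Estar - δ) (Estar + δ), 0 < deriv V (c E))
    (I : ℝ → ℝ)
    (hI : ∀ E : ℝ, I E =
      (Real.sqrt 2 / Real.pi) * ∫ q in d E..c E, Real.sqrt (E - V q)) :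
    HasDerivAt I
      ((Real.sqrt 2 / (2 * Real.pi)) *
        ∫ q in d Estar..c Estar, 1 / Real.sqrt (Estar - V q)) Estar := by
  have hE : Estar ∈ Set.Ioo (Estar - δ) (Estar + δ) := ⟨by linarith, by linarith⟩
  have hU : Set.Ioo (Estar - δ) (Estar + δ) ∈ nhds Estar := isOpen_Ioo.mem_nhds hE
  have hVcont : Continuous V := hV.continuous
  have hVdiff : Differentiable ℝ V := hV.differentiable (by norm_num)
  have hV' : Continuous (deriv V) := hV.continuous_deriv (by norm_num)
  obtain ⟨η₁, hη₁, H₁⟩ := aux_int V (c Estar) _ (hc' _ hE).ne' (hVdiff _).hasDerivAt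
  obtain ⟨η₂, hη₂, H₂⟩ := aux_int V (d Estar) _ (hd' _ hE).ne (hVdiff _).hasDerivAt
  obtain ⟨η₃, hη₃, H₃⟩ := Metric.eventually_nhds_iff.1
    (hV'.continuousAt.eventually_const_lt (hc' _ hE))
  obtain ⟨η₄, hη₄, H₄⟩ := Metric.eventually_nhds_iff.1
    (hV'.continuousAt.eventually_lt_const (hd' _ hE))
  have hdc := hord _ hE
  obtain ⟨η, hη, hηlt⟩ : ∃ η > 0, η < min (min η₁ η₂) (min (min η₃ η₄) ((c Estar - d Estar) / 2)) :=
    exists_between (by simp only [lt_min_iff]; refine ⟨⟨hη₁, hη₂⟩, ⟨hη₃, hη₄⟩, by linarith⟩)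
  simp only [lt_min_iff] at hηlt
  obtain ⟨⟨g₁, g₂⟩, ⟨g₃, g₄⟩, g₅⟩ := hηlt
  have hmono : StrictMonoOn V (Icc (c Estar - η) (c Estar + η)) := by
    refine strictMonoOn_of_deriv_pos (convex_Icc _ _) hVcont.continuousOn fun x hx => ?_
    rw [interior_Icc] at hx
    exact H₃ (by rw [Real.dist_eq, abs_lt]; constructor <;> linarith [hx.1, hx.2])
  have hanti : StrictAntiOn V (Icc (d Estar - η) (d Estar + η)) := by
    refine strictAntiOn_of_deriv_neg (convex_Icc _ _) hVcont.continuousOn fun x hx => ?_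
    rw [interior_Icc] at hx
    exact H₄ (by rw [Real.dist_eq, abs_lt]; constructor <;> linarith [hx.1, hx.2])
  have hAB : d Estar - η ≤ c Estar + η := by linarith
  -- sign outside
  have hout : ∀ E ∈ Set.Ioo (Estar - δ) (Estar + δ), |c E - c Estar| < η → |d E - d Estar| < η →
      ∀ q ∈ Ioc (d Estar - η) (c Estar + η) \ Ioc (d E) (c E), E - V q ≤ 0 := by
    intro E hEU h1 h2 q hq
    rw [abs_lt] at h1 h2
    obtain ⟨⟨q1, q2⟩, q3⟩ := hq
    rw [mem_Ioc, not_and_or, not_lt, not_le] at q3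
    rcases q3 with q3 | q3
    · have := hanti.antitoneOn (a := q) ⟨by linarith, by linarith⟩ (b := d E)
        ⟨by linarith, by linarith⟩ q3
      rw [hVd E hEU] at this; linarith
    · have := hmono.monotoneOn (a := c E) ⟨by linarith, by linarith⟩ (b := q)
        ⟨by linarith, by linarith⟩ q3.le
      rw [hVc E hEU] at this; linarith
  have hsub : ∀ E, |c E - c Estar| < η → |d E - d Estar| < η →
      Ioc (d E) (c E) ⊆ Ioc (d Estar - η) (c Estar + η) := by
    intro E h1 h2
    rw [abs_lt] at h1 h2
    exact Ioc_subset_Ioc (by linarith) (by linarith)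
  -- nonvanishing
  have hnv : ∀ q ∈ Ioc (d Estar - η) (c Estar + η), q ≠ c Estar → q ≠ d Estar →
      Estar - V q ≠ 0 := by
    intro q hq h1 h2 h0
    rcases lt_or_gt_of_ne h2 with h | h
    · have := hanti (a := q) ⟨by linarith [hq.1], by linarith⟩ (b := d Estar)
        ⟨by linarith, by linarith⟩ h
      rw [hVd _ hE] at this; linarith
    · rcases lt_or_gt_of_ne h1 with h' | h'
      · linarith [hlt _ hE q ⟨h, h'⟩]
      · have := hmono (a := c Estar) ⟨by linarith, by linarith⟩ (b := q)
          ⟨by linarith, by linarith [hq.2]⟩ h'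
        rw [hVc _ hE] at this; linarith
  have hbd : IntervalIntegrable (fun q => 1 / Real.sqrt |Estar - V q|) MeasureTheory.volume
      (d Estar - η) (c Estar + η) := by
    have i1 := aux_int2 V hVcont (d Estar) _ (d Estar - η) (d Estar + η)
      (half_pos (abs_pos.2 (hd' _ hE).ne)) (fun q hq => H₂ q (by
        rw [uIoc_of_le (by linarith)] at hq
        rw [abs_lt]; constructor <;> linarith [hq.1, hq.2]))
    have i3 := aux_int2 V hVcont (c Estar) _ (c Estar - η) (c Estar + η)
      (half_pos (abs_pos.2 (hc' _ hE).ne')) (fun q hq => H₁ q (by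
        rw [uIoc_of_le (by linarith)] at hq
        rw [abs_lt]; constructor <;> linarith [hq.1, hq.2]))
    rw [hVd _ hE] at i1
    rw [hVc _ hE] at i3
    refine (i1.trans ?_).trans i3
    refine ContinuousOn.intervalIntegrable ?_
    refine ContinuousOn.div continuousOn_const (by fun_prop) fun q hq => ?_
    rw [uIcc_of_le (by linarith)] at hq
    have := hlt _ hE q ⟨by linarith [hq.1], by linarith [hq.2]⟩
    exact (Real.sqrt_pos.2 (abs_pos.2 (sub_pos.2 this).ne')).ne'
  have hae : ∀ᵐ q ∂(MeasureTheory.volume.restrict (Ioc (d Estar - η) (c Estar + η))),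
      Estar - V q ≠ 0 := by
    rw [MeasureTheory.ae_restrict_iff' measurableSet_Ioc]
    have n1 : ∀ᵐ q : ℝ, q ≠ c Estar := by simp [MeasureTheory.ae_iff]
    have n2 : ∀ᵐ q : ℝ, q ≠ d Estar := by simp [MeasureTheory.ae_iff]
    filter_upwards [n1, n2] with q h1 h2 hq using hnv q hq h1 h2
  have key := hasFDerivAt_integral_of_dominated_loc_of_lip' (𝕜 := ℝ)
    (μ := MeasureTheory.volume.restrict (Ioc (d Estar - η) (c Estar + η)))
    (F := fun E q => Real.sqrt (E - V q)) (x₀ := Estar) (s := univ)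
    (F' := fun q => ContinuousLinearMap.smulRightL ℝ ℝ ℝ 1 (1 / (2 * Real.sqrt (Estar - V q))))
    (bound := fun q => 1 / Real.sqrt |Estar - V q|)
    Filter.univ_mem
    (fun x _ => Measurable.aestronglyMeasurable (by fun_prop))
    (by
      have : Continuous fun q => Real.sqrt (Estar - V q) := by fun_prop
      exact (this.integrableOn_Ioc))
    ((ContinuousLinearMap.continuous _).comp_aestronglyMeasurable
      (Measurable.aestronglyMeasurable (by fun_prop)))
    (by
      filter_upwards [hae] with q hq x _
      have := aux_sqrt (x - V q) (Estar - V q) hq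
      simpa only [Real.norm_eq_abs, sub_sub_sub_cancel_right] using this)
    ((intervalIntegrable_iff_integrableOn_Ioc_of_le hAB).1 hbd)
    (by
      filter_upwards [hae] with q hq
      have := ((hasDerivAt_id Estar).sub_const (V q)).sqrt hq
      exact this.hasFDerivAt)
  obtain ⟨kint, kd⟩ := key
  have kd2 := kd.hasDerivAt
  rw [ContinuousLinearMap.integral_apply kint] at kd2
  have hI' : I =ᶠ[nhds Estar] fun E => (Real.sqrt 2 / Real.pi) *
      ∫ q in Ioc (d Estar - η) (c Estar + η), Real.sqrt (E - V q) := by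
    have c1 := ((hc.differentiableAt hU).continuousAt).eventually (Metric.ball_mem_nhds _ hη)
    have c2 := ((hd.differentiableAt hU).continuousAt).eventually (Metric.ball_mem_nhds _ hη)
    filter_upwards [c1, c2, hU] with E h1 h2 hEU
    rw [Real.dist_eq] at h1 h2
    rw [hI, integral_of_le (hord E hEU).le,
      MeasureTheory.setIntegral_eq_of_subset_of_forall_sdiff_eq_zero measurableSet_Ioc
        (hsub E h1 h2) (fun q hq => Real.sqrt_eq_zero_of_nonpos (hout E hEU h1 h2 q hq))]
  have fin := (kd2.const_mul (Real.sqrt 2 / Real.pi)).congr_of_eventuallyEq hI'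
  refine fin.congr_deriv (Eq.symm ?_)
  have z : ∀ x : ℝ, |x - x| < η := by simpa using hη
  rw [integral_of_le hdc.le,
    ← MeasureTheory.setIntegral_eq_of_subset_of_forall_sdiff_eq_zero measurableSet_Ioc
      (hsub Estar (z _) (z _)) (fun q hq => by
        rw [Real.sqrt_eq_zero_of_nonpos (hout Estar hE (z _) (z _) q hq), div_zero])]
  have : ∀ q, (ContinuousLinearMap.smulRightL ℝ ℝ ℝ 1 (1 / (2 * Real.sqrt (Estar - V q)))) (1:ℝ)
      = (1/2) * (1 / Real.sqrt (Estar - V q)) := by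
    intro q
    simp [mul_comm]
  simp only [this]
  rw [MeasureTheory.integral_const_mul]
  ring
end

section
/- Let δ > 0, ν > 0 and let W(q) = q²/2 − ν/(δ − q) for q < δ. Then: (i) a point q < δ is a critical point of W (i.e. W'(q) = 0) if and only if q > 0 and q·(δ − q)² = ν; (ii) if 0 < ν < 4δ³/27, then W has exactly two critical points on (−∞, δ), namely a point q₀ ∈ (0, δ/3) with W''(q₀) > 0 (a strict local minimum) and a point q₁ ∈ (δ/3, δ) with W''(q₁) < 0 (a strict local maximum); (iii) if ν > 4δ³/27, then W has no critical points on (−∞, δ). -/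
/-- Critical points of the MEMS electrostatic potential
`W(q) = q²/2 − ν/(δ − q)` on `(−∞, δ)`: characterisation of critical points,
existence of exactly two critical points (a strict local minimum and a strict
local maximum) below the static pull-in threshold `ν = 4δ³/27`, and absence of
critical points above it. -/
theorem mems_critical_points (δ ν : ℝ) (hδ : 0 < δ) (hν : 0 < ν)
    (W : ℝ → ℝ) (hW : ∀ q : ℝ, q < δ → W q = q ^ 2 / 2 - ν / (δ - q)) :
    (∀ q : ℝ, q < δ → (deriv W q = 0 ↔ 0 < q ∧ q * (δ - q) ^ 2 = ν)) ∧
    (ν < 4 * δ ^ 3 / 27 →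
      ∃ q₀ q₁ : ℝ, q₀ ∈ Set.Ioo 0 (δ / 3) ∧ q₁ ∈ Set.Ioo (δ / 3) δ ∧
        deriv W q₀ = 0 ∧ deriv W q₁ = 0 ∧
        0 < iteratedDeriv 2 W q₀ ∧ iteratedDeriv 2 W q₁ < 0 ∧
        (∀ᶠ x in nhdsWithin q₀ {q₀}ᶜ, W q₀ < W x) ∧
        (∀ᶠ x in nhdsWithin q₁ {q₁}ᶜ, W x < W q₁) ∧
        (∀ q : ℝ, q < δ → deriv W q = 0 → q = q₀ ∨ q = q₁)) ∧
    (4 * δ ^ 3 / 27 < ν → ∀ q : ℝ, q < δ → deriv W q ≠ 0) := by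
  have hev : ∀ q : ℝ, q < δ → W =ᶠ[nhds q] fun x => x ^ 2 / 2 - ν / (δ - x) := by
    intro q hq
    filter_upwards [Iio_mem_nhds hq] with x hx using hW x hx
  have hd : ∀ q : ℝ, q < δ → deriv W q = q - ν / (δ - q) ^ 2 := by
    intro q hq
    have hne : δ - q ≠ 0 := by linarith
    rw [(hev q hq).deriv_eq]
    have h := (((hasDerivAt_id q).pow 2).div_const 2).sub
      ((hasDerivAt_const q ν).div ((hasDerivAt_id q).const_sub δ) hne)
    refine HasDerivAt.deriv (h.congr_deriv ?_)
    simp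
    try field_simp
    try ring
  have hd2 : ∀ q : ℝ, q < δ → iteratedDeriv 2 W q = 1 - 2 * ν / (δ - q) ^ 3 := by
    intro q hq
    have hne : δ - q ≠ 0 := by linarith
    have he : deriv W =ᶠ[nhds q] fun x => x - ν / (δ - x) ^ 2 := by
      filter_upwards [Iio_mem_nhds hq] with x hx using hd x hx
    rw [iteratedDeriv_succ, iteratedDeriv_one, he.deriv_eq]
    have h := (hasDerivAt_id q).sub
      ((hasDerivAt_const q ν).div (((hasDerivAt_id q).const_sub δ).pow 2) (pow_ne_zero 2 hne))
    refine HasDerivAt.deriv (h.congr_deriv ?_)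
    simp
    try field_simp
    try ring
  have hc : ∀ q : ℝ, q < δ → (deriv W q = 0 ↔ 0 < q ∧ q * (δ - q) ^ 2 = ν) := by
    intro q hq
    have hp : 0 < (δ - q) ^ 2 := pow_pos (by linarith) 2
    rw [hd q hq, sub_eq_zero, eq_div_iff hp.ne']
    refine ⟨fun h => ⟨?_, h⟩, fun h => h.2⟩
    by_contra hn
    nlinarith [mul_nonneg (by linarith : 0 ≤ -q) hp.le]
  have hs : ∀ q : ℝ, q < δ → q * (δ - q) ^ 2 = ν →
      iteratedDeriv 2 W q = (δ - 3 * q) / (δ - q) := by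
    intro q hq h
    have hne : δ - q ≠ 0 := by linarith
    rw [hd2 q hq, ← h]
    field_simp
    ring
  have hdiff : ∀ q x : ℝ, q < δ → x < δ → q * (δ - q) ^ 2 = ν →
      W x - W q = (x - q) ^ 2 * ((δ - x - 2 * q) / (2 * (δ - x))) := by
    intro q x hq hx h
    have hne : δ - q ≠ 0 := by linarith
    have hne' : δ - x ≠ 0 := by linarith
    rw [hW q hq, hW x hx, ← h]
    field_simp
    ring
  refine ⟨hc, ?_, ?_⟩
  · intro hlt
    have hcont : Continuous fun q : ℝ => q * (δ - q) ^ 2 := by fun_prop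
    obtain ⟨a, ⟨ha0, ha1⟩, ha⟩ := intermediate_value_Ioo (by linarith : (0:ℝ) ≤ δ / 3)
      hcont.continuousOn (show ν ∈ Set.Ioo _ _ from ⟨by simpa using hν, by
        show ν < δ / 3 * (δ - δ / 3) ^ 2
        nlinarith⟩)
    obtain ⟨b, ⟨hb0, hb1⟩, hb⟩ := intermediate_value_Ioo' (by linarith : δ / 3 ≤ δ)
      hcont.continuousOn (show ν ∈ Set.Ioo _ _ from ⟨by simpa using hν, by
        show ν < δ / 3 * (δ - δ / 3) ^ 2
        nlinarith⟩)
    replace ha : a * (δ - a) ^ 2 = ν := ha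
    replace hb : b * (δ - b) ^ 2 = ν := hb
    have haδ : a < δ := by linarith
    refine ⟨a, b, ⟨ha0, ha1⟩, ⟨hb0, hb1⟩, (hc a haδ).2 ⟨ha0, ha⟩,
      (hc b hb1).2 ⟨by linarith, hb⟩, ?_, ?_, ?_, ?_, ?_⟩
    · rw [hs a haδ ha]
      exact div_pos (by linarith) (by linarith)
    · rw [hs b hb1 hb]
      exact div_neg_of_neg_of_pos (by linarith) (by linarith)
    · filter_upwards [self_mem_nhdsWithin,
        mem_nhdsWithin_of_mem_nhds (Iio_mem_nhds (by linarith : a < δ - 2 * a))] with x hx hx'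
      have hx'' : x < δ - 2 * a := hx'
      have hne : x - a ≠ 0 := sub_ne_zero.2 hx
      have := hdiff a x haδ (by linarith) ha
      have h2 : 0 < (x - a) ^ 2 * ((δ - x - 2 * a) / (2 * (δ - x))) :=
        mul_pos (by positivity) (div_pos (by linarith) (by linarith))
      linarith
    · filter_upwards [self_mem_nhdsWithin,
        mem_nhdsWithin_of_mem_nhds (Iio_mem_nhds hb1),
        mem_nhdsWithin_of_mem_nhds (Ioi_mem_nhds (by linarith : δ - 2 * b < b))] with x hx hx1 hx2
      have hx1' : x < δ := hx1
      have hx2' : δ - 2 * b < x := hx2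
      have hne : x - b ≠ 0 := sub_ne_zero.2 hx
      have := hdiff b x hb1 hx1' hb
      have h2 : (x - b) ^ 2 * ((δ - x - 2 * b) / (2 * (δ - x))) < 0 :=
        mul_neg_of_pos_of_neg (by positivity)
          (div_neg_of_neg_of_pos (by linarith) (by linarith))
      linarith
    · intro q hq h
      obtain ⟨-, hqe⟩ := (hc q hq).1 h
      by_contra! hcon
      have hqa : q - a ≠ 0 := sub_ne_zero.2 hcon.1
      have hqb : q - b ≠ 0 := sub_ne_zero.2 hcon.2
      have hab : a - b ≠ 0 := by linarith
      have e1 : δ ^ 2 - 2 * δ * (q + a) + (q ^ 2 + q * a + a ^ 2) = 0 := by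
        apply mul_left_cancel₀ hqa
        linear_combination hqe - ha
      have e2 : δ ^ 2 - 2 * δ * (q + b) + (q ^ 2 + q * b + b ^ 2) = 0 := by
        apply mul_left_cancel₀ hqb
        linear_combination hqe - hb
      have e3 : q = 2 * δ - a - b := by
        apply mul_left_cancel₀ hab
        linear_combination e1 - e2
      have hpos : 0 < (δ - a) * (δ - b) * (δ - q) :=
        mul_pos (mul_pos (by linarith) (by linarith)) (by linarith)
      have e4 : (δ - a) * (δ - b) * (δ - q) = -ν := by
        subst e3
        linear_combination -(δ - a) * e1 - ha
      linarith
  · intro hlt q hq h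
    obtain ⟨-, hqe⟩ := (hc q hq).1 h
    nlinarith [mul_nonneg (sq_nonneg (q - δ / 3)) (by linarith : 0 ≤ 4 * δ / 3 - q)]
end
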